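/- arXiv:2312.12489 — 3 statements merged into one kernel-verified Lean document; each statement's English description precedes it below -/
import Mathlib

section
/- Suppose E[f] = 0 and Cov(f) is positive definite. Define g* : Y → ℝ^d by g*(y) = Cov(f)⁻¹ μ_f(y). Then for every map g : Y → ℝ^d one has H(f, g) ≤ H(f, g*), and equality holds if and only if there exists a constant vector c ∈ ℝ^d with g(y) = g*(y) + c for all y ∈ Y. -/
noncomputable section

open Matrix BigOperators

variable {X Y : Type*} [Fintype X] [Fintype Y]

/-- Marginal distribution of `X` under the joint pmf `p`. -/
def PX (p : X × Y → ℝ) (x : X) : ℝ := ∑ y, p (x, y)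

/-- Marginal distribution of `Y` under the joint pmf `p`. -/
def PY (p : X × Y → ℝ) (y : Y) : ℝ := ∑ x, p (x, y)

/-- Mean `E[f] = Σ_x P_X(x) f(x)` of a feature map. -/
def fmean {d : ℕ} (p : X × Y → ℝ) (f : X → Fin d → ℝ) : Fin d → ℝ :=
  ∑ x, PX p x • f x

/-- Covariance matrix `Cov(f) = Σ_x P_X(x) (f(x) − E[f])(f(x) − E[f])ᵀ`. -/
def fcov {d : ℕ} (p : X × Y → ℝ) (f : X → Fin d → ℝ) : Matrix (Fin d) (Fin d) ℝ :=
  ∑ x, PX p x • vecMulVec (f x - fmean p f) (f x - fmean p f)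

/-- Conditional mean `μ_f(y) = (1/P_Y(y)) Σ_x p(x,y) f(x)`. -/
def condMean {d : ℕ} (p : X × Y → ℝ) (f : X → Fin d → ℝ) (y : Y) : Fin d → ℝ :=
  (PY p y)⁻¹ • ∑ x, p (x, y) • f x

/-- Mean `E[g] = Σ_y P_Y(y) g(y)` of a classifier map. -/
def gmean {d : ℕ} (p : X × Y → ℝ) (g : Y → Fin d → ℝ) : Fin d → ℝ :=
  ∑ y, PY p y • g y

/-- Covariance matrix `Cov(g) = Σ_y P_Y(y) (g(y) − E[g])(g(y) − E[g])ᵀ`. -/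
def gcov {d : ℕ} (p : X × Y → ℝ) (g : Y → Fin d → ℝ) : Matrix (Fin d) (Fin d) ℝ :=
  ∑ y, PY p y • vecMulVec (g y - gmean p g) (g y - gmean p g)

/-- H-score `H(f,g) = Σ_{x,y} p(x,y) f(x)ᵀ g(y) − (1/2) tr(Cov(f)·Cov(g))`. -/
def Hscore {d : ℕ} (p : X × Y → ℝ) (f : X → Fin d → ℝ) (g : Y → Fin d → ℝ) : ℝ :=
  (∑ x, ∑ y, p (x, y) * (f x ⬝ᵥ g y)) - (1 / 2) * (fcov p f * gcov p g).trace

/-- MCR loss `L(f,g) = Σ_x P_X(x) Σ_y [P_Y(y)(1 + f(x)ᵀ g(y)) − p(x,y)/P_X(x)]² / P_Y(y)`. -/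
def Lloss {d : ℕ} (p : X × Y → ℝ) (f : X → Fin d → ℝ) (g : Y → Fin d → ℝ) : ℝ :=
  ∑ x, PX p x * ∑ y, (PY p y * (1 + f x ⬝ᵥ g y) - p (x, y) / PX p x) ^ 2 / PY p y

theorem trace_mul_gcov {d : ℕ} (p : X × Y → ℝ) (M : Matrix (Fin d) (Fin d) ℝ)
    (g : Y → Fin d → ℝ) :
    (M * gcov p g).trace =
      ∑ y, PY p y * ((g y - gmean p g) ⬝ᵥ M *ᵥ (g y - gmean p g)) := by
  simp only [gcov, Matrix.mul_sum, Matrix.mul_smul, Matrix.trace_sum, Matrix.trace_smul,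
    smul_eq_mul, Matrix.mul_vecMulVec, Matrix.trace_vecMulVec]
  refine Finset.sum_congr rfl fun y _ => ?_
  rw [dotProduct_comm]

omit [Fintype Y] in
theorem PY_smul_condMean {d : ℕ} (p : X × Y → ℝ) (f : X → Fin d → ℝ) {y : Y}
    (hy : PY p y ≠ 0) : PY p y • condMean p f y = ∑ x, p (x, y) • f x := by
  rw [condMean, smul_inv_smul₀ hy]

theorem gmean_condMean {d : ℕ} (p : X × Y → ℝ) (f : X → Fin d → ℝ)
    (hPY : ∀ y, PY p y ≠ 0) : gmean p (condMean p f) = fmean p f := by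
  simp only [gmean, fmean, PX, PY_smul_condMean p f (hPY _), Finset.sum_smul]
  exact Finset.sum_comm

theorem gmean_mulVec {d : ℕ} (p : X × Y → ℝ) (M : Matrix (Fin d) (Fin d) ℝ)
    (g : Y → Fin d → ℝ) : gmean p (fun y => M *ᵥ g y) = M *ᵥ gmean p g := by
  simp only [gmean, Matrix.mulVec_sum, Matrix.mulVec_smul]

theorem gmean_add_const {d : ℕ} (p : X × Y → ℝ) (hp : ∑ x, ∑ y, p (x, y) = 1)
    (g : Y → Fin d → ℝ) (c : Fin d → ℝ) : gmean p (fun y => g y + c) = gmean p g + c := by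
  have h : ∑ y, PY p y = 1 := by rw [← hp]; exact Finset.sum_comm
  simp only [gmean, smul_add, Finset.sum_add_distrib, ← Finset.sum_smul, h, one_smul]

theorem sum_dotProduct_eq {d : ℕ} (p : X × Y → ℝ) (f : X → Fin d → ℝ) (g : Y → Fin d → ℝ)
    (hPY : ∀ y, PY p y ≠ 0) :
    ∑ x, ∑ y, p (x, y) * (f x ⬝ᵥ g y) = ∑ y, PY p y * (condMean p f y ⬝ᵥ g y) := by
  rw [Finset.sum_comm]
  refine Finset.sum_congr rfl fun y _ => ?_
  rw [← smul_eq_mul, ← smul_dotProduct, PY_smul_condMean p f (hPY y), sum_dotProduct]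
  simp only [smul_dotProduct, smul_eq_mul]

/-- Completing the square: the H-score deficit of `g` relative to `h` is a quadratic form in
the centered difference. -/
theorem Hscore_eq_sub {d : ℕ} (p : X × Y → ℝ) (f : X → Fin d → ℝ) (g h : Y → Fin d → ℝ)
    (hPY : ∀ y, PY p y ≠ 0) (hC : (fcov p f).IsSymm)
    (hh : ∀ y, fcov p f *ᵥ h y = condMean p f y) (hmean : gmean p h = 0) :
    Hscore p f g = Hscore p f h - 1 / 2 * ∑ y, PY p y *
      ((g y - gmean p g - h y) ⬝ᵥ fcov p f *ᵥ (g y - gmean p g - h y)) := by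
  have hsymm (u v : Fin d → ℝ) : u ⬝ᵥ fcov p f *ᵥ v = v ⬝ᵥ fcov p f *ᵥ u := by
    rw [dotProduct_mulVec, ← mulVec_transpose, hC.eq, dotProduct_comm]
  have hzero : ∑ y, PY p y * (fcov p f *ᵥ h y ⬝ᵥ gmean p g) = 0 := by
    have := gmean_mulVec p (fcov p f) h
    rw [hmean, mulVec_zero] at this
    simp only [← smul_eq_mul, ← smul_dotProduct, ← sum_dotProduct]
    rw [← gmean, this, zero_dotProduct]
  rw [Hscore, Hscore, sum_dotProduct_eq p f g hPY, sum_dotProduct_eq p f h hPY,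
    trace_mul_gcov, trace_mul_gcov, hmean, ← sub_eq_zero, ← hzero]
  simp only [← hh, sub_zero, Finset.mul_sum, ← Finset.sum_sub_distrib]
  refine Finset.sum_congr rfl fun y _ => ?_
  generalize gmean p g = m
  have hg : g y = (g y - m) + m := by abel
  generalize g y - m = u at hg ⊢
  rw [hg, mulVec_sub, sub_dotProduct, dotProduct_sub, dotProduct_sub, dotProduct_add,
    hsymm u (h y), dotProduct_comm _ u, dotProduct_comm _ (h y), hsymm u (h y)]
  ring

/-- with `E[f] = 0` and `Cov(f)` positive definite, the classifier
`g*(y) = Cov(f)⁻¹ μ_f(y)` maximizes the H-score, with equality exactly for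
constant shifts of `g*`. -/
theorem hscore_optimal_classifier
    {X Y : Type*} [Fintype X] [Fintype Y] [Nonempty X] [Nonempty Y] {d : ℕ}
    (p : X × Y → ℝ)
    (hp_nonneg : ∀ x y, 0 ≤ p (x, y))
    (hp_sum : ∑ x, ∑ y, p (x, y) = 1)
    (hPX_pos : ∀ x, 0 < PX p x) (hPY_pos : ∀ y, 0 < PY p y)
    (f : X → Fin d → ℝ) (hf_mean : fmean p f = 0)
    (hf_cov : (fcov p f).PosDef)
    (gstar : Y → Fin d → ℝ)
    (hgstar : ∀ y, gstar y = (fcov p f)⁻¹ *ᵥ condMean p f y)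
    (g : Y → Fin d → ℝ) :
    Hscore p f g ≤ Hscore p f gstar ∧
      (Hscore p f g = Hscore p f gstar ↔
        ∃ c : Fin d → ℝ, ∀ y, g y = gstar y + c) := by
  have hPY : ∀ y, PY p y ≠ 0 := fun y => (hPY_pos y).ne'
  have hC : (fcov p f).IsSymm := by
    simpa [Matrix.IsHermitian, Matrix.IsSymm] using hf_cov.isHermitian
  have hstar : ∀ y, fcov p f *ᵥ gstar y = condMean p f y := fun y => by
    rw [hgstar, mulVec_mulVec, mul_nonsing_inv _ ((isUnit_iff_isUnit_det _).mp hf_cov.isUnit),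
      one_mulVec]
  have hmean : gmean p gstar = 0 := by
    rw [funext hgstar, gmean_mulVec, gmean_condMean p f hPY, hf_mean, mulVec_zero]
  have hquad_nonneg (v : Fin d → ℝ) : 0 ≤ v ⬝ᵥ fcov p f *ᵥ v := by
    simpa using hf_cov.posSemidef.dotProduct_mulVec_nonneg v
  have hterm_nonneg : ∀ y ∈ Finset.univ, 0 ≤ PY p y * ((g y - gmean p g - gstar y) ⬝ᵥ
      fcov p f *ᵥ (g y - gmean p g - gstar y)) :=
    fun y _ => mul_nonneg (hPY_pos y).le (hquad_nonneg _)
  have hsum_nonneg := Finset.sum_nonneg hterm_nonneg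
  have hkey := Hscore_eq_sub p f g gstar hPY hC hstar hmean
  refine ⟨by linarith, fun heq => ⟨gmean p g, fun y => ?_⟩, ?_⟩
  · have hy := (Finset.sum_eq_zero_iff_of_nonneg hterm_nonneg).mp (by linarith) y
      (Finset.mem_univ y)
    have hquad := (mul_eq_zero.mp hy).resolve_left (hPY y)
    have hv : g y - gmean p g - gstar y = 0 := by
      by_contra hne
      have := hf_cov.dotProduct_mulVec_pos hne
      simp only [star_trivial] at this
      exact this.ne' hquad
    rw [← sub_eq_zero, ← hv]
    abel
  · rintro ⟨c, hc⟩
    have hm : gmean p g = c := by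
      rw [funext hc, gmean_add_const p hp_sum, hmean, zero_add]
    rw [hkey, hm]
    simp [hc]

end
end

section
/- Suppose E[f] = 0, and let g₁, g₂ : Y → ℝ^d be classifier maps with E[g₁] = 0 and E[g₂] = 0. Then L(f, g₁) ≤ L(f, g₂) if and only if H(f, g₁) ≥ H(f, g₂). Consequently, among zero-mean classifiers, g minimizes the MCR loss L(f, ·) if and only if g maximizes the H-score H(f, ·). -/
noncomputable section

open Matrix BigOperators

variable {X Y : Type*} [Fintype X] [Fintype Y]

/-- For zero-mean `f` and `g`, the trace term of the H-score is the second moment of `f(x)ᵀ g(y)`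
under the product of the marginals. -/
theorem trace_fcov_mul_gcov {d : ℕ} {p : X × Y → ℝ} {f : X → Fin d → ℝ} {g : Y → Fin d → ℝ}
    (hf : fmean p f = 0) (hg : gmean p g = 0) :
    (fcov p f * gcov p g).trace = ∑ x, ∑ y, PX p x * PY p y * (f x ⬝ᵥ g y) ^ 2 := by
  simp only [fcov, gcov, hf, hg, sub_zero, Finset.sum_mul, Finset.mul_sum, trace_sum,
    smul_mul_assoc, mul_smul_comm, trace_smul, vecMulVec_mul_vecMulVec, trace_vecMulVec,
    dotProduct_smul, smul_eq_mul]
  rw [Finset.sum_comm]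
  refine Finset.sum_congr rfl fun x _ => Finset.sum_congr rfl fun y _ => ?_
  ring

theorem sum_PX_mul_PY_mul_dotProduct {d : ℕ} {p : X × Y → ℝ} {f : X → Fin d → ℝ}
    (g : Y → Fin d → ℝ) (hf : fmean p f = 0) :
    ∑ x, ∑ y, PX p x * PY p y * (f x ⬝ᵥ g y) = 0 := by
  have h : ∀ y, ∑ x, PX p x * PY p y * (f x ⬝ᵥ g y) = PY p y * (fmean p f ⬝ᵥ g y) := by
    intro y
    simp only [fmean, sum_dotProduct, smul_dotProduct, smul_eq_mul, Finset.mul_sum]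
    exact Finset.sum_congr rfl fun x _ => by ring
  rw [Finset.sum_comm]
  simp [h, hf]

/-- For zero-mean `f` and `g`, the MCR loss is an affine decreasing function of the H-score. -/
theorem Lloss_eq_sub_two_mul_Hscore {d : ℕ} {p : X × Y → ℝ}
    (hPX : ∀ x, PX p x ≠ 0) (hPY : ∀ y, PY p y ≠ 0) {f : X → Fin d → ℝ} {g : Y → Fin d → ℝ}
    (hf : fmean p f = 0) (hg : gmean p g = 0) :
    Lloss p f g = Lloss p f 0 - 2 * Hscore p f g := by
  have h : Lloss p f g = Lloss p f 0 + 2 * (∑ x, ∑ y, PX p x * PY p y * (f x ⬝ᵥ g y))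
      + (∑ x, ∑ y, PX p x * PY p y * (f x ⬝ᵥ g y) ^ 2)
      - 2 * ∑ x, ∑ y, p (x, y) * (f x ⬝ᵥ g y) := by
    simp only [Lloss, Finset.mul_sum, ← Finset.sum_add_distrib, ← Finset.sum_sub_distrib]
    refine Finset.sum_congr rfl fun x _ => Finset.sum_congr rfl fun y _ => ?_
    have := hPX x
    have := hPY y
    simp only [Pi.zero_apply, dotProduct_zero]
    field_simp
    ring
  rw [h, sum_PX_mul_PY_mul_dotProduct g hf, Hscore, trace_fcov_mul_gcov hf hg]
  ring

/-- for a zero-mean feature and zero-mean classifiers, the order on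
MCR losses is the reverse of the order on H-scores; consequently a zero-mean
classifier minimizes `L(f,·)` over zero-mean classifiers iff it maximizes
`H(f,·)` over them. -/
theorem mcr_loss_hscore_order_reversal
    {X Y : Type*} [Fintype X] [Fintype Y] [Nonempty X] [Nonempty Y] {d : ℕ}
    (p : X × Y → ℝ)
    (hp_nonneg : ∀ x y, 0 ≤ p (x, y))
    (hp_sum : ∑ x, ∑ y, p (x, y) = 1)
    (hPX_pos : ∀ x, 0 < PX p x) (hPY_pos : ∀ y, 0 < PY p y)
    (f : X → Fin d → ℝ) (hf_mean : fmean p f = 0) :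
    (∀ g₁ g₂ : Y → Fin d → ℝ, gmean p g₁ = 0 → gmean p g₂ = 0 →
      (Lloss p f g₁ ≤ Lloss p f g₂ ↔ Hscore p f g₂ ≤ Hscore p f g₁)) ∧
    (∀ g : Y → Fin d → ℝ, gmean p g = 0 →
      ((∀ g' : Y → Fin d → ℝ, gmean p g' = 0 → Lloss p f g ≤ Lloss p f g') ↔
        (∀ g' : Y → Fin d → ℝ, gmean p g' = 0 → Hscore p f g' ≤ Hscore p f g))) := by
  have order : ∀ g₁ g₂ : Y → Fin d → ℝ, gmean p g₁ = 0 → gmean p g₂ = 0 →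
      (Lloss p f g₁ ≤ Lloss p f g₂ ↔ Hscore p f g₂ ≤ Hscore p f g₁) := by
    intro g₁ g₂ h₁ h₂
    have hPX x := (hPX_pos x).ne'
    have hPY y := (hPY_pos y).ne'
    rw [Lloss_eq_sub_two_mul_Hscore hPX hPY hf_mean h₁,
      Lloss_eq_sub_two_mul_Hscore hPX hPY hf_mean h₂]
    constructor <;> intro h <;> linarith
  exact ⟨order, fun g hg => forall₂_congr fun g' hg' => order g g' hg hg'⟩

end
end

section
/- Suppose E[f] = 0 and Cov(f) is positive definite, and let g*(y) = Cov(f)⁻¹ μ_f(y). Then the maximum of the H-score over all classifiers equals half the one-sided H-score of f: for every g : Y → ℝ^d, H(f, g) ≤ H(f, g*) = (1/2) tr( Cov(f)⁻¹ · Σ_y P_Y(y) μ_f(y) μ_f(y)ᵀ ). -/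
noncomputable section

open Matrix BigOperators

variable {X Y : Type*} [Fintype X] [Fintype Y]

theorem sum_smul_condMean {X Y : Type*} [Fintype X] [Fintype Y] {d : ℕ} (p : X × Y → ℝ)
    (hPY : ∀ y, 0 < PY p y) (f : X → Fin d → ℝ) :
    ∑ y, PY p y • condMean p f y = fmean p f := by
  simp only [condMean, smul_inv_smul₀ (hPY _).ne', fmean, PX, Finset.sum_smul]
  exact Finset.sum_comm

theorem sum_mul_dotProduct_eq_condMean {X Y : Type*} [Fintype X] [Fintype Y] {d : ℕ}
    (p : X × Y → ℝ) (hPY : ∀ y, 0 < PY p y) (f : X → Fin d → ℝ) (g : Y → Fin d → ℝ) :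
    ∑ x, ∑ y, p (x, y) * (f x ⬝ᵥ g y) = ∑ y, PY p y * (condMean p f y ⬝ᵥ g y) := by
  rw [Finset.sum_comm]
  refine Finset.sum_congr rfl fun y _ => ?_
  rw [← smul_eq_mul (PY p y), ← smul_dotProduct, condMean, smul_inv_smul₀ (hPY y).ne',
    sum_dotProduct]
  simp only [smul_dotProduct, smul_eq_mul]

theorem trace_mul_sum_smul_vecMulVec {ι n : Type*} [Fintype ι] [Fintype n]
    (S : Matrix n n ℝ) (w : ι → ℝ) (h : ι → n → ℝ) :
    (S * ∑ i, w i • vecMulVec (h i) (h i)).trace = ∑ i, w i * (h i ⬝ᵥ S *ᵥ h i) := by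
  simp only [Matrix.mul_sum, trace_sum, Matrix.mul_smul, trace_smul, mul_vecMulVec,
    trace_vecMulVec, smul_eq_mul, dotProduct_comm]

/-- For a centred feature map the H-score only sees the centred classifier. -/
theorem Hscore_eq_sum_centered {X Y : Type*} [Fintype X] [Fintype Y] {d : ℕ} (p : X × Y → ℝ)
    (hPY : ∀ y, 0 < PY p y) (f : X → Fin d → ℝ) (hf : fmean p f = 0) (g : Y → Fin d → ℝ) :
    Hscore p f g = ∑ y, PY p y * (condMean p f y ⬝ᵥ (g y - gmean p g) -
      (1 / 2) * ((g y - gmean p g) ⬝ᵥ fcov p f *ᵥ (g y - gmean p g))) := by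
  have hc : ∑ y, PY p y * (condMean p f y ⬝ᵥ gmean p g) = 0 := by
    have h := congrArg (· ⬝ᵥ gmean p g) ((sum_smul_condMean p hPY f).trans hf)
    simpa only [sum_dotProduct, smul_dotProduct, smul_eq_mul, zero_dotProduct] using h
  rw [Hscore, gcov, trace_mul_sum_smul_vecMulVec, sum_mul_dotProduct_eq_condMean p hPY]
  simp only [dotProduct_sub (condMean p f _), mul_sub (PY p _), Finset.sum_sub_distrib, hc,
    sub_zero, Finset.mul_sum, mul_left_comm (1 / 2 : ℝ)]

theorem Matrix.PosDef.mulVec_inv_mulVec {n : Type*} [Fintype n] [DecidableEq n]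
    {S : Matrix n n ℝ} (hS : S.PosDef) (m : n → ℝ) : S *ᵥ S⁻¹ *ᵥ m = m := by
  rw [mulVec_mulVec, mul_nonsing_inv S ((isUnit_iff_isUnit_det S).mp hS.isUnit), one_mulVec]

/-- Completing the square in the concave quadratic `h ↦ m ⬝ᵥ h - (1/2) h ⬝ᵥ S h`. -/
theorem Matrix.PosDef.dotProduct_sub_half_quadratic_le {n : Type*} [Fintype n] [DecidableEq n]
    {S : Matrix n n ℝ} (hS : S.PosDef) (m h : n → ℝ) :
    m ⬝ᵥ h - (1 / 2) * (h ⬝ᵥ S *ᵥ h) ≤ (1 / 2) * (m ⬝ᵥ S⁻¹ *ᵥ m) := by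
  have hnn : 0 ≤ (h - S⁻¹ *ᵥ m) ⬝ᵥ S *ᵥ (h - S⁻¹ *ᵥ m) := by
    simpa using hS.posSemidef.dotProduct_mulVec_nonneg (h - S⁻¹ *ᵥ m)
  have hT : Sᵀ = S := by simpa using hS.isHermitian.eq
  have hcross : S⁻¹ *ᵥ m ⬝ᵥ S *ᵥ h = m ⬝ᵥ h := by
    rw [dotProduct_mulVec, ← mulVec_transpose, hT, hS.mulVec_inv_mulVec]
  rw [mulVec_sub, hS.mulVec_inv_mulVec, sub_dotProduct, dotProduct_sub, dotProduct_sub, hcross,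
    dotProduct_comm h m, dotProduct_comm (S⁻¹ *ᵥ m) m] at hnn
  linarith

/-- with `E[f] = 0` and `Cov(f)` positive definite, the maximal
H-score, attained at `g*(y) = Cov(f)⁻¹ μ_f(y)`, equals half the one-sided
H-score `tr(Cov(f)⁻¹ · Σ_y P_Y(y) μ_f(y) μ_f(y)ᵀ)`. -/
theorem hscore_max_is_half_one_sided_hscore
    {X Y : Type*} [Fintype X] [Fintype Y] [Nonempty X] [Nonempty Y] {d : ℕ}
    (p : X × Y → ℝ)
    (hp_nonneg : ∀ x y, 0 ≤ p (x, y))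
    (hp_sum : ∑ x, ∑ y, p (x, y) = 1)
    (hPX_pos : ∀ x, 0 < PX p x) (hPY_pos : ∀ y, 0 < PY p y)
    (f : X → Fin d → ℝ) (hf_mean : fmean p f = 0)
    (hf_cov : (fcov p f).PosDef)
    (gstar : Y → Fin d → ℝ)
    (hgstar : ∀ y, gstar y = (fcov p f)⁻¹ *ᵥ condMean p f y)
    (g : Y → Fin d → ℝ) :
    Hscore p f g ≤ Hscore p f gstar ∧
      Hscore p f gstar =
        (1 / 2) * ((fcov p f)⁻¹ *
          ∑ y, PY p y • vecMulVec (condMean p f y) (condMean p f y)).trace := by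
  have hg0 : gmean p gstar = 0 := by
    simp only [gmean, hgstar, ← mulVec_smul, ← mulVec_sum, sum_smul_condMean p hPY_pos, hf_mean,
      mulVec_zero]
  have hstar : Hscore p f gstar =
      ∑ y, PY p y * ((1 / 2) * (condMean p f y ⬝ᵥ (fcov p f)⁻¹ *ᵥ condMean p f y)) := by
    rw [Hscore_eq_sum_centered p hPY_pos f hf_mean]
    refine Finset.sum_congr rfl fun y _ => ?_
    rw [hg0, sub_zero, hgstar, hf_cov.mulVec_inv_mulVec, dotProduct_comm (_ *ᵥ _)]
    ring
  constructor
  · rw [hstar, Hscore_eq_sum_centered p hPY_pos f hf_mean]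
    exact Finset.sum_le_sum fun y _ => mul_le_mul_of_nonneg_left
      (hf_cov.dotProduct_sub_half_quadratic_le _ _) (hPY_pos y).le
  · rw [hstar, trace_mul_sum_smul_vecMulVec, Finset.mul_sum]
    exact Finset.sum_congr rfl fun y _ => mul_left_comm _ _ _

end
end
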